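/- arXiv:1112.3262 — 2 statements merged into one kernel-verified Lean document; each statement's English description precedes it below -/
import Mathlib

section
/- If f : [a,b] → ℝ is in AC²([a,b]) (f is C¹ with f' absolutely continuous), then the composition of the left Caputo half-derivative with itself recovers the first derivative: ᶜD₊^{1/2}(ᶜD₊^{1/2} f)(t) = f'(t) for a.e. t ∈ [a,b]. -/
open MeasureTheory intervalIntegral Set

/-- Left Riemann-Liouville fractional integral on `[a, ·]`. -/
noncomputable def fracInt (a β : ℝ) (f : ℝ → ℝ) (t : ℝ) : ℝ :=
  (1 / Real.Gamma β) * ∫ τ in a..t, (t - τ) ^ (β - 1) * f τ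

/-- Left Riemann-Liouville fractional derivative of order `α ∈ [0,1)`. -/
noncomputable def rlDeriv (a α : ℝ) (f : ℝ → ℝ) : ℝ → ℝ :=
  deriv (fracInt a (1 - α) f)

/-- Left Caputo fractional derivative of order `α ∈ [0,1)`. -/
noncomputable def caputoDeriv (a α : ℝ) (f : ℝ → ℝ) : ℝ → ℝ :=
  fracInt a (1 - α) (deriv f)

/-- Right Riemann-Liouville fractional integral on `[·, b]`. -/
noncomputable def fracIntR (b β : ℝ) (f : ℝ → ℝ) (t : ℝ) : ℝ :=
  (1 / Real.Gamma β) * ∫ τ in t..b, (τ - t) ^ (β - 1) * f τ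

/-- Right Riemann-Liouville fractional derivative of order `α ∈ [0,1)`. -/
noncomputable def rlDerivR (b α : ℝ) (f : ℝ → ℝ) (t : ℝ) : ℝ :=
  - deriv (fracIntR b (1 - α) f) t

/-- Right Caputo fractional derivative of order `α ∈ [0,1)`. -/
noncomputable def caputoDerivR (b α : ℝ) (f : ℝ → ℝ) (t : ℝ) : ℝ :=
  - fracIntR b (1 - α) (deriv f) t

theorem beta_half_value {x : ℝ} (hx : 0 < x) :
    ∫ y in (0:ℝ)..x, (x - y) ^ (-1/2 : ℝ) * y ^ (-1/2 : ℝ) = Real.pi := by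
  have h1 := Complex.betaIntegral_scaled (1/2) (1/2) hx
  have h2 := Complex.Gamma_mul_Gamma_eq_betaIntegral (s := 1/2) (t := 1/2) (by norm_num) (by norm_num)
  have h3 : (1/2 : ℂ) + 1/2 = 1 := by norm_num
  rw [h3, Complex.Gamma_one, one_mul, Complex.Gamma_one_half_eq, ← Complex.cpow_add _ _
    (by exact_mod_cast Real.pi_ne_zero), h3, Complex.cpow_one] at h2
  rw [h3, sub_self, Complex.cpow_zero, one_mul, ← h2] at h1
  have h4 : ∫ y in (0:ℝ)..x, (((x - y) ^ (-1/2 : ℝ) * y ^ (-1/2 : ℝ) : ℝ) : ℂ) = (Real.pi : ℂ) := by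
    rw [← h1]
    apply intervalIntegral.integral_congr
    intro y hy
    rw [uIcc_of_le hx.le] at hy
    simp only
    rw [Complex.ofReal_mul, Complex.ofReal_cpow (by linarith [hy.2]), Complex.ofReal_cpow hy.1, mul_comm]
    push_cast
    norm_num
  rw [intervalIntegral.integral_ofReal] at h4
  exact_mod_cast h4

theorem tri_fubini (p q m F : ℝ → ℝ) (a t C : ℝ) (hat : a ≤ t)
    (hp : Measurable p) (hq : Measurable q) (hp0 : ∀ x, 0 ≤ x → 0 ≤ p x) (hq0 : ∀ x, 0 ≤ q x)
    (hqz : ∀ x ≤ 0, q x = 0)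
    (hm : ∀ x, 0 < x → ∫ y in (0:ℝ)..x, p (x - y) * q y = m x)
    (hm0 : ∀ x, 0 < x → m x ≠ 0) (hC : ∀ x, 0 < x → x ≤ t - a → m x ≤ C)
    (hF : IntervalIntegrable F volume a t) :
    IntervalIntegrable (fun s => p (t - s) * ∫ r in a..s, q (s - r) * F r) volume a t ∧
    ∫ s in a..t, p (t - s) * (∫ r in a..s, q (s - r) * F r) = ∫ r in a..t, m (t - r) * F r := by
  set μ := volume.restrict (Ioo a t) with hμ
  have hF' : Integrable F μ := by
    rwa [intervalIntegrable_iff_integrableOn_Ioo_of_le hat] at hF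
  let G : ℝ × ℝ → ℝ := fun z => p (t - z.1) * (q (z.1 - z.2) * F z.2)
  have hGm : AEStronglyMeasurable G (μ.prod μ) := by
    refine AEStronglyMeasurable.mul ?_ (AEStronglyMeasurable.mul ?_ ?_)
    · exact (hp.comp (by fun_prop)).aestronglyMeasurable
    · exact (hq.comp (by fun_prop)).aestronglyMeasurable
    · exact hF'.1.comp_snd
  have key1 : ∀ r ∈ Ioo a t, ∫ s in Ioo r t, p (t - s) * q (s - r) = m (t - r) := by
    intro r hr
    rw [← hm (t - r) (by linarith [hr.2]), ← integral_Ioc_eq_integral_Ioo,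
      ← intervalIntegral.integral_of_le hr.2.le]
    have := intervalIntegral.integral_comp_sub_right (a := r) (b := t)
      (fun y => p (t - r - y) * q y) r
    rw [sub_self] at this
    rw [← this]
    congr 1; ext s
    congr 2; ring
  have key2 : ∀ r ∈ Ioo a t, ∫ s, p (t - s) * q (s - r) ∂μ = m (t - r) := by
    intro r hr
    rw [← key1 r hr]
    refine setIntegral_eq_of_subset_of_forall_sdiff_eq_zero measurableSet_Ioo
      (Ioo_subset_Ioo_left hr.1.le) ?_
    rintro s ⟨hs, hs'⟩
    rw [hqz (s - r), mul_zero]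
    by_contra hc
    exact hs' ⟨by linarith, hs.2⟩
  have key3 : ∀ r ∈ Ioo a t, Integrable (fun s => p (t - s) * q (s - r)) μ := by
    intro r hr
    by_contra hc
    have := key2 r hr
    rw [integral_undef hc] at this
    exact hm0 (t - r) (by linarith [hr.2]) this.symm
  have hpq : ∀ r, ∀ s ∈ Ioo a t, 0 ≤ p (t - s) * q (s - r) := fun r s hs =>
    mul_nonneg (hp0 _ (by linarith [hs.2])) (hq0 _)
  have hmn : ∀ r ∈ Ioo a t, 0 ≤ m (t - r) := by
    intro r hr
    rw [← key2 r hr]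
    exact setIntegral_nonneg measurableSet_Ioo (hpq r)
  have hG : Integrable G (μ.prod μ) := by
    rw [integrable_prod_iff' hGm]
    constructor
    · refine (ae_restrict_iff' measurableSet_Ioo).2 (Filter.Eventually.of_forall fun r hr => ?_)
      have := (key3 r hr).mul_const (F r)
      simpa only [G, mul_assoc] using this
    · refine Integrable.mono' (hF'.norm.const_mul C) hGm.norm.prod_swap.integral_prod_right' ?_
      refine (ae_restrict_iff' measurableSet_Ioo).2 (Filter.Eventually.of_forall fun r hr => ?_)
      have e : ∫ s, ‖G (s, r)‖ ∂μ = m (t - r) * ‖F r‖ := by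
        rw [← key2 r hr, ← MeasureTheory.integral_mul_const]
        refine setIntegral_congr_fun measurableSet_Ioo fun s hs => ?_
        simp only [G]
        rw [← mul_assoc, norm_mul, Real.norm_of_nonneg (hpq r s hs)]
      rw [e, Real.norm_of_nonneg (mul_nonneg (hmn r hr) (norm_nonneg _))]
      exact mul_le_mul_of_nonneg_right (hC _ (by linarith [hr.2]) (by linarith [hr.1])) (norm_nonneg _)
  have inner : ∀ s ∈ Ioo a t, ∫ r, G (s, r) ∂μ = p (t - s) * ∫ r in a..s, q (s - r) * F r := by
    intro s hs
    simp only [G]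
    rw [MeasureTheory.integral_const_mul, intervalIntegral.integral_of_le hs.1.le,
      integral_Ioc_eq_integral_Ioo]
    congr 1
    refine setIntegral_eq_of_subset_of_forall_sdiff_eq_zero measurableSet_Ioo
      (Ioo_subset_Ioo_right hs.2.le) ?_
    rintro r ⟨hr, hr'⟩
    rw [hqz (s - r), zero_mul]
    by_contra hc
    exact hr' ⟨hr.1, by linarith⟩
  constructor
  · rw [intervalIntegrable_iff_integrableOn_Ioo_of_le hat]
    exact (integrable_congr ((ae_restrict_iff' measurableSet_Ioo).2
      (Filter.Eventually.of_forall inner))).1 hG.integral_prod_left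
  · rw [intervalIntegral.integral_of_le hat, intervalIntegral.integral_of_le hat,
      integral_Ioc_eq_integral_Ioo, integral_Ioc_eq_integral_Ioo,
      ← setIntegral_congr_fun measurableSet_Ioo inner]
    have := integral_integral_swap (f := fun s r => G (s, r)) hG
    refine this.trans ?_
    refine setIntegral_congr_fun measurableSet_Ioo fun r hr => ?_
    simp only [G]
    rw [← key2 r hr, ← MeasureTheory.integral_mul_const]
    simp only [mul_assoc]

theorem k_zero {x : ℝ} (hx : x ≤ 0) : x ^ (-1/2 : ℝ) = 0 := by
  rcases hx.eq_or_lt with rfl | h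
  · rw [Real.zero_rpow (by norm_num)]
  · rw [Real.rpow_def_of_neg h, show (-1/2 : ℝ) * Real.pi = -(Real.pi / 2) by ring, Real.cos_neg,
      Real.cos_pi_div_two, mul_zero]

theorem k_nonneg (x : ℝ) : 0 ≤ x ^ (-1/2 : ℝ) := by
  rcases le_or_gt x 0 with h | h
  · rw [k_zero h]
  · positivity

theorem int_k_right (x : ℝ) (hx : 0 < x) :
    ∫ y in (0:ℝ)..x, y ^ (-1/2 : ℝ) = 2 * x ^ (1/2 : ℝ) := by
  rw [integral_rpow (Or.inl (by norm_num)), show (-1/2 + 1 : ℝ) = 1/2 by norm_num,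
    Real.zero_rpow (by norm_num)]
  ring

theorem int_k_left (x : ℝ) (hx : 0 < x) :
    ∫ y in (0:ℝ)..x, (x - y) ^ (-1/2 : ℝ) = 2 * x ^ (1/2 : ℝ) := by
  rw [← int_k_right x hx]
  have := intervalIntegral.integral_comp_sub_left (a := 0) (b := x) (fun y => y ^ (-1/2 : ℝ)) x
  simpa using this

theorem ii_k_left (a t x : ℝ) :
    IntervalIntegrable (fun s => (t - s) ^ (-1/2 : ℝ)) volume a x := by
  have := (intervalIntegral.intervalIntegrable_rpow' (a := t - a) (b := t - x)
    (r := -1/2) (by norm_num)).comp_sub_left t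
  simpa using this

theorem ii_k_right (a t x : ℝ) :
    IntervalIntegrable (fun s => (s - a) ^ (-1/2 : ℝ)) volume t x := by
  have := (intervalIntegral.intervalIntegrable_rpow' (a := t - a) (b := x - a)
    (r := -1/2) (by norm_num)).comp_sub_right a
  simpa using this

theorem main_aux (a b c : ℝ) (F : ℝ → ℝ) (hab : a < b) (hF : IntervalIntegrable F volume a b)
    (φ g h : ℝ → ℝ) (hφ : ∀ t ∈ Icc a b, φ t = c + ∫ s in a..t, F s)
    (hg : ∀ t ∈ Icc a b, g t = ∫ τ in a..t, (t - τ) ^ (-1/2 : ℝ) * φ τ)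
    (hh : ∀ s, h s = c * (s - a) ^ (-1/2 : ℝ) + ∫ r in a..s, (s - r) ^ (-1/2 : ℝ) * F r) :
    IntervalIntegrable h volume a b ∧ (∀ t ∈ Icc a b, g t = ∫ s in a..t, h s) ∧
    ∀ t ∈ Ioc a b, ∫ s in a..t, (t - s) ^ (-1/2 : ℝ) * h s = Real.pi * φ t := by
  have hFt : ∀ t ∈ Icc a b, IntervalIntegrable F volume a t := fun t ht =>
    hF.mono_set (by rw [uIcc_of_le ht.1, uIcc_of_le hab.le]; exact Icc_subset_Icc_right ht.2)
  have kmeas : Measurable (fun x : ℝ => x ^ (-1/2 : ℝ)) := by fun_prop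
  have mbd : ∀ t x : ℝ, 0 < x → x ≤ t - a → 2 * x ^ (1/2 : ℝ) ≤ 2 * (t - a) ^ (1/2 : ℝ) := by
    intro t x hx hxt
    gcongr
  have T1 := fun t (ht : t ∈ Icc a b) => tri_fubini (fun x => x ^ (-1/2 : ℝ))
    (fun x => x ^ (-1/2 : ℝ)) (fun _ => Real.pi) F a t Real.pi ht.1 kmeas kmeas
    (fun x _ => k_nonneg x) k_nonneg (fun x hx => k_zero hx) (fun x hx => beta_half_value hx)
    (fun _ _ => Real.pi_ne_zero) (fun _ _ _ => le_rfl) (hFt t ht)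
  have T2 := fun t (ht : t ∈ Icc a b) => tri_fubini (fun x => x ^ (-1/2 : ℝ))
    ((Ioi 0).indicator 1) (fun x => 2 * x ^ (1/2 : ℝ)) F a t _ ht.1 kmeas
    (measurable_one.indicator measurableSet_Ioi)
    (fun x _ => k_nonneg x) (fun x => indicator_nonneg (fun _ _ => zero_le_one) x)
    (fun x hx => indicator_of_notMem (by simpa using hx) _)
    (fun x hx => by
      rw [← int_k_left x hx, intervalIntegral.integral_of_le hx.le,
        intervalIntegral.integral_of_le hx.le]
      refine setIntegral_congr_fun measurableSet_Ioc fun y hy => ?_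
      simp [hy.1])
    (fun x hx => by positivity) (mbd t) (hFt t ht)
  have T3 := fun t (ht : t ∈ Icc a b) => tri_fubini (fun _ => 1)
    (fun x => x ^ (-1/2 : ℝ)) (fun x => 2 * x ^ (1/2 : ℝ)) F a t _ ht.1 measurable_const
    kmeas (fun x _ => zero_le_one) k_nonneg
    (fun x hx => k_zero hx)
    (fun x hx => by rw [← int_k_right x hx]; simp)
    (fun x hx => by positivity) (mbd t) (hFt t ht)
  simp only [one_mul] at T3
  have hh' : h = fun s => c * (s - a) ^ (-1/2 : ℝ) + ∫ r in a..s, (s - r) ^ (-1/2 : ℝ) * F r :=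
    funext hh
  refine ⟨?_, ?_, ?_⟩
  · rw [hh']
    exact ((ii_k_right a a b).const_mul c).add (T3 b ⟨hab.le, le_rfl⟩).1
  · intro t ht
    rcases ht.1.eq_or_lt with rfl | hat
    · rw [hg _ ht]; simp
    have e1 : ∫ s in a..t, h s = c * (2 * (t - a) ^ (1/2 : ℝ)) +
        ∫ r in a..t, 2 * (t - r) ^ (1/2 : ℝ) * F r := by
      rw [hh', intervalIntegral.integral_add ((ii_k_right a a t).const_mul c) (T3 t ht).1,
        (T3 t ht).2, intervalIntegral.integral_const_mul, ← int_k_right (t - a) (by linarith)]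
      congr 2
      have := intervalIntegral.integral_comp_sub_right (a := a) (b := t)
        (fun y => y ^ (-1/2 : ℝ)) a
      simpa using this
    have e2 : ∀ s ∈ Icc a t, (t - s) ^ (-1/2 : ℝ) * φ s = c * (t - s) ^ (-1/2 : ℝ) +
        (t - s) ^ (-1/2 : ℝ) * ∫ r in a..s, (Ioi (0:ℝ)).indicator 1 (s - r) * F r := by
      intro s hs
      have : ∫ r in a..s, (Ioi (0:ℝ)).indicator 1 (s - r) * F r = ∫ r in a..s, F r := by
        rw [intervalIntegral.integral_of_le hs.1, intervalIntegral.integral_of_le hs.1,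
          integral_Ioc_eq_integral_Ioo, integral_Ioc_eq_integral_Ioo]
        refine setIntegral_congr_fun measurableSet_Ioo fun y hy => ?_
        simp [hy.2]
      rw [this, hφ s ⟨hs.1, hs.2.trans ht.2⟩]
      ring
    rw [e1, hg t ht, ← (T2 t ht).2]
    rw [intervalIntegral.integral_congr (g := fun s => c * (t - s) ^ (-1/2 : ℝ) +
        (t - s) ^ (-1/2 : ℝ) * ∫ r in a..s, (Ioi (0:ℝ)).indicator 1 (s - r) * F r)
        (fun s hs => e2 s (by rwa [uIcc_of_le ht.1] at hs)),
      intervalIntegral.integral_add ((ii_k_left a t t).const_mul c) (T2 t ht).1,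
      intervalIntegral.integral_const_mul, ← int_k_right (t - a) (by linarith)]
    congr 2
    have := intervalIntegral.integral_comp_sub_left (a := a) (b := t)
        (fun y => y ^ (-1/2 : ℝ)) t
    simpa using this
  · intro t ht
    have ht' : t ∈ Icc a b := ⟨ht.1.le, ht.2⟩
    have e0 : ∫ s in a..t, (t - s) ^ (-1/2 : ℝ) * (s - a) ^ (-1/2 : ℝ) = Real.pi := by
      rw [← beta_half_value (x := t - a) (by linarith [ht.1])]
      have := intervalIntegral.integral_comp_sub_right (a := a) (b := t)
        (fun y => (t - a - y) ^ (-1/2 : ℝ) * y ^ (-1/2 : ℝ)) a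
      simpa using this
    have i0 : IntervalIntegrable (fun s => (t - s) ^ (-1/2 : ℝ) * (s - a) ^ (-1/2 : ℝ)) volume a t :=
      intervalIntegral.intervalIntegrable_of_integral_ne_zero (by rw [e0]; exact Real.pi_ne_zero)
    have : (fun s => (t - s) ^ (-1/2 : ℝ) * h s) = fun s =>
        c * ((t - s) ^ (-1/2 : ℝ) * (s - a) ^ (-1/2 : ℝ)) +
        (t - s) ^ (-1/2 : ℝ) * ∫ r in a..s, (s - r) ^ (-1/2 : ℝ) * F r := by
      ext s; rw [hh s]; ring
    rw [this, intervalIntegral.integral_add (i0.const_mul c) (T1 t ht').1, (T1 t ht').2,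
      intervalIntegral.integral_const_mul, e0, intervalIntegral.integral_const_mul, hφ t ht']
    ring

/-- composition rule `ᶜD₊^{1/2} ∘ ᶜD₊^{1/2} = d/dt` for `f ∈ AC²([a,b])`
(`f` is `C¹` with absolutely continuous derivative). -/
theorem caputo_half_comp_caputo_half (a b : ℝ) (hab : a < b) (f f' f'' : ℝ → ℝ)
    (hf : ∀ t ∈ Set.Icc a b, HasDerivAt f (f' t) t)
    (hf''int : IntervalIntegrable f'' volume a b)
    (hf'AC : ∀ t ∈ Set.Icc a b, f' t = f' a + ∫ s in a..t, f'' s) :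
    ∀ᵐ t ∂(volume.restrict (Set.Icc a b)),
      caputoDeriv a (1/2) (caputoDeriv a (1/2) f) t = f' t := by
  have hcap : ∀ u t, caputoDeriv a (1/2) u t =
      (1 / Real.sqrt Real.pi) * ∫ τ in a..t, (t - τ) ^ (-1/2 : ℝ) * deriv u τ := by
    intro u t
    rw [caputoDeriv, fracInt, show (1 - 1/2 : ℝ) = 1/2 by norm_num, Real.Gamma_one_half_eq,
      show (1/2 - 1 : ℝ) = -1/2 by norm_num]
  set h : ℝ → ℝ := fun s => f' a * (s - a) ^ (-1/2 : ℝ) +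
    ∫ r in a..s, (s - r) ^ (-1/2 : ℝ) * f'' r with hh
  obtain ⟨hi, hgi, hfin⟩ := main_aux a b (f' a) f'' hab hf''int f'
    (fun t => ∫ τ in a..t, (t - τ) ^ (-1/2 : ℝ) * f' τ) h hf'AC (fun _ _ => rfl) (fun _ => rfl)
  have hg : ∀ t ∈ Icc a b, caputoDeriv a (1/2) f t = (1 / Real.sqrt Real.pi) * ∫ s in a..t, h s := by
    intro t ht
    rw [hcap, ← hgi t ht]
    congr 1
    refine intervalIntegral.integral_congr fun s hs => ?_
    rw [uIcc_of_le ht.1] at hs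
    rw [(hf s ⟨hs.1, hs.2.trans ht.2⟩).deriv]
  have hd : ∀ᵐ s, s ∈ Ioo a b → deriv (caputoDeriv a (1/2) f) s = (1 / Real.sqrt Real.pi) * h s := by
    filter_upwards [hi.ae_hasDerivAt_integral] with s hs hsI
    have h1 := (hs (by rw [uIcc_of_le hab.le]; exact Ioo_subset_Icc_self hsI) a left_mem_uIcc).const_mul
      (1 / Real.sqrt Real.pi)
    refine (h1.congr_of_eventuallyEq ?_).deriv
    filter_upwards [Ioo_mem_nhds hsI.1 hsI.2] with t ht
    exact hg t (Ioo_subset_Icc_self ht)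
  have hane : ∀ᵐ t : ℝ, t ≠ a := by simp [ae_iff, measure_singleton]
  have hbne : ∀ᵐ t : ℝ, t ≠ b := by simp [ae_iff, measure_singleton]
  rw [ae_restrict_iff' measurableSet_Icc]
  filter_upwards [hane] with t hta ht
  have ht' : t ∈ Ioc a b := ⟨lt_of_le_of_ne ht.1 (Ne.symm hta), ht.2⟩
  rw [hcap]
  have : ∫ τ in a..t, (t - τ) ^ (-1/2 : ℝ) * deriv (caputoDeriv a (1/2) f) τ =
      ∫ τ in a..t, (1 / Real.sqrt Real.pi) * ((t - τ) ^ (-1/2 : ℝ) * h τ) := by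
    refine intervalIntegral.integral_congr_ae ?_
    filter_upwards [hd, hbne] with s hs hsb hsI
    rw [uIoc_of_le ht.1] at hsI
    rw [hs ⟨hsI.1, lt_of_le_of_ne (hsI.2.trans ht.2) hsb⟩]
    ring
  rw [this, intervalIntegral.integral_const_mul, hfin t ht', ← mul_assoc, ← mul_assoc]
  have hp : Real.sqrt Real.pi ≠ 0 := (Real.sqrt_pos.2 Real.pi_pos).ne'
  have : 1 / Real.sqrt Real.pi * (1 / Real.sqrt Real.pi) * Real.pi = 1 := by
    field_simp
    rw [Real.sq_sqrt Real.pi_pos.le]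
  rw [this, one_mul]
end

section
/- Fractional integration by parts (Riemann-Liouville–Caputo form): for 0 ≤ α < 1, f ∈ AC¹([a,b]) and g ∈ C¹([a,b]) with g(a) = g(b) = 0, ∫_a^b (D₊^α f)(t) g(t) dt = ∫_a^b f(t) (ᶜD₋^α g)(t) dt. -/
open MeasureTheory intervalIntegral Set

/-- Truncated kernel on the triangle. -/
noncomputable def triPhi (a b : ℝ) (k p q : ℝ → ℝ) (z : ℝ × ℝ) : ℝ :=
  ((Ioo a b).indicator p z.2 * (Ioo 0 (b - a)).indicator k (z.1 - z.2)) *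
    (Ioo a b).indicator q z.1

theorem triPhi_inner_right (a b : ℝ) (k p q : ℝ → ℝ) (t : ℝ) :
    ∫ τ, triPhi a b k p q (t, τ) =
      (Ioo a b).indicator (fun t => (∫ τ in a..t, k (t - τ) * p τ) * q t) t := by
  by_cases ht : t ∈ Ioo a b
  · rw [indicator_of_mem ht, intervalIntegral.integral_of_le ht.1.le,
      integral_Ioc_eq_integral_Ioo, ← MeasureTheory.integral_mul_const,
      ← MeasureTheory.integral_indicator measurableSet_Ioo]
    congr 1
    ext τ
    obtain ⟨h1, h2⟩ := ht
    simp only [triPhi, indicator, mem_Ioo]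
    split_ifs <;> first | ring1 | (exfalso; grind)
  · rw [indicator_of_notMem ht]
    simp [triPhi, indicator_of_notMem ht]

theorem triPhi_inner_left (a b : ℝ) (k p q : ℝ → ℝ) (τ : ℝ) :
    ∫ t, triPhi a b k p q (t, τ) =
      (Ioo a b).indicator (fun τ => p τ * (∫ t in τ..b, k (t - τ) * q t)) τ := by
  by_cases ht : τ ∈ Ioo a b
  · rw [indicator_of_mem ht, intervalIntegral.integral_of_le ht.2.le,
      integral_Ioc_eq_integral_Ioo, ← MeasureTheory.integral_const_mul,
      ← MeasureTheory.integral_indicator measurableSet_Ioo]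
    congr 1
    ext t
    obtain ⟨h1, h2⟩ := ht
    simp only [triPhi, indicator, mem_Ioo]
    split_ifs <;> first | ring1 | (exfalso; grind)
  · rw [indicator_of_notMem ht]
    simp [triPhi, indicator_of_notMem ht]

theorem tri_swap (a b : ℝ) (hab : a ≤ b) (k p q : ℝ → ℝ)
    (h : Integrable (triPhi a b k p q) (volume.prod volume)) :
    ∫ t in a..b, (∫ τ in a..t, k (t - τ) * p τ) * q t =
      ∫ τ in a..b, p τ * (∫ t in τ..b, k (t - τ) * q t) := by
  have := integral_integral_swap (f := fun t τ => triPhi a b k p q (t, τ)) h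
  simp only [triPhi_inner_right, triPhi_inner_left] at this
  rw [MeasureTheory.integral_indicator measurableSet_Ioo, MeasureTheory.integral_indicator measurableSet_Ioo] at this
  rw [intervalIntegral.integral_of_le hab, intervalIntegral.integral_of_le hab,
    integral_Ioc_eq_integral_Ioo, integral_Ioc_eq_integral_Ioo, this]

theorem tri_integrable (a b : ℝ) (hab : a ≤ b) (k p q : ℝ → ℝ)
    (h : Integrable (triPhi a b k p q) (volume.prod volume)) :
    IntervalIntegrable (fun t => (∫ τ in a..t, k (t - τ) * p τ) * q t) volume a b := by
  have := h.integral_prod_left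
  simp only [triPhi_inner_right] at this
  rw [integrable_indicator_iff measurableSet_Ioo] at this
  rwa [intervalIntegrable_iff_integrableOn_Ioo_of_le hab]

theorem ind_int {a b : ℝ} (hab : a ≤ b) {p : ℝ → ℝ} (hp : IntervalIntegrable p volume a b) :
    Integrable ((Ioo a b).indicator p) volume := by
  rw [integrable_indicator_iff measurableSet_Ioo]
  rwa [intervalIntegrable_iff_integrableOn_Ioo_of_le hab] at hp

/-- Integrability for an integrable kernel and a continuous test function. -/
theorem triPhi_int_cont (a b : ℝ) (hab : a ≤ b) (k p q : ℝ → ℝ)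
    (hk : IntervalIntegrable k volume 0 (b - a)) (hp : IntervalIntegrable p volume a b)
    (hq : ContinuousOn q (Icc a b)) :
    Integrable (triPhi a b k p q) (volume.prod volume) := by
  have h1 := (ind_int hab hp).convolution_integrand (ContinuousLinearMap.mul ℝ ℝ)
    (ind_int (sub_nonneg.2 hab) hk) (μ := volume)
  obtain ⟨C, hC⟩ := isCompact_Icc.exists_bound_of_continuousOn hq
  have hqi := (ind_int hab (hq.intervalIntegrable_of_Icc hab)).aestronglyMeasurable
  refine h1.mul_bdd (c := |C|) hqi.comp_fst (Filter.Eventually.of_forall fun z => ?_)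
  by_cases hz : z.1 ∈ Ioo a b
  · rw [indicator_of_mem hz]
    exact (hC _ (Ioo_subset_Icc_self hz)).trans (le_abs_self _)
  · rw [indicator_of_notMem hz]; simp

/-- Integrability for the constant kernel. -/
theorem triPhi_int_one (a b : ℝ) (hab : a ≤ b) (p q : ℝ → ℝ)
    (hp : IntervalIntegrable p volume a b)
    (hq : IntervalIntegrable q volume a b) :
    Integrable (triPhi a b (fun _ => 1) p q) (volume.prod volume) := by
  have h1 := (ind_int hab hq).mul_prod (ind_int hab hp)
  have hm : Measurable (fun z : ℝ × ℝ =>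
      (Ioo 0 (b - a)).indicator (fun _ => (1 : ℝ)) (z.1 - z.2)) :=
    (measurable_const.indicator measurableSet_Ioo).comp (measurable_fst.sub measurable_snd)
  refine (h1.mul_bdd (c := 1) hm.aestronglyMeasurable
    (Filter.Eventually.of_forall fun z => ?_)).congr (Filter.Eventually.of_forall fun z => ?_)
  · simp only [indicator]; split_ifs <;> simp
  · simp only [triPhi]; ring

theorem swap_one (a b : ℝ) (hab : a ≤ b) (p q : ℝ → ℝ)
    (hp : IntervalIntegrable p volume a b)
    (hq : IntervalIntegrable q volume a b) :
    ∫ t in a..b, (∫ τ in a..t, p τ) * q t = ∫ τ in a..b, p τ * (∫ t in τ..b, q t) := by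
  simpa using tri_swap a b hab _ p q (triPhi_int_one a b hab p q hp hq)

theorem kernel_refl (k : ℝ → ℝ) (r T : ℝ) :
    ∫ t in r..T, k (t - r) = ∫ t in r..T, k (T - t) := by
  rw [intervalIntegral.integral_comp_sub_right, intervalIntegral.integral_comp_sub_left]
  simp

/-- The convolution of a kernel with an absolutely continuous function is a primitive. -/
theorem frac_primitive (a T : ℝ) (haT : a ≤ T) (k f f' : ℝ → ℝ)
    (hk : ∀ x y, IntervalIntegrable k volume x y)
    (hf' : IntervalIntegrable f' volume a T)
    (hf : ∀ t ∈ Icc a T, f t = f a + ∫ s in a..t, f' s) :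
    ∫ τ in a..T, k (T - τ) * f τ =
      ∫ t in a..T, (f a * k (t - a) + ∫ τ in a..t, k (t - τ) * f' τ) := by
  have hk1 : IntervalIntegrable (fun t => k (t - a)) volume a T := by
    simpa using (hk 0 (T - a)).comp_sub_right a
  have hk2 : IntervalIntegrable (fun t => k (T - t)) volume a T := by
    simpa using (hk (T - a) 0).comp_sub_left T
  have hc := triPhi_int_cont a T haT k f' (fun _ => 1) (hk _ _) hf' continuousOn_const
  have e1 := tri_swap a T haT _ _ _ hc
  have i1 := tri_integrable a T haT _ _ _ hc
  have hd := triPhi_int_one a T haT f' (fun t => k (T - t)) hf' hk2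
  have e2 := tri_swap a T haT _ _ _ hd
  have i2 := tri_integrable a T haT _ _ _ hd
  simp only [mul_one, one_mul] at e1 i1 e2 i2
  rw [intervalIntegral.integral_add (hk1.const_mul _) i1, e1]
  have : ∫ τ in a..T, k (T - τ) * f τ =
      ∫ τ in a..T, (f a * k (T - τ) + (∫ s in a..τ, f' s) * k (T - τ)) := by
    apply intervalIntegral.integral_congr
    intro τ hτ
    rw [uIcc_of_le haT] at hτ
    simp only []
    rw [hf τ hτ]; ring
  rw [this, intervalIntegral.integral_add (hk2.const_mul _) i2, e2]
  simp only [kernel_refl, intervalIntegral.integral_const_mul]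

/-- fractional integration by parts (Riemann-Liouville–Caputo):
`∫ (D₊^α f) g = ∫ f (ᶜD₋^α g)` for `f ∈ AC¹`, `g ∈ C¹₀([a,b])`. -/
theorem rl_caputo_integration_by_parts (a b α : ℝ) (hab : a < b)
    (hα0 : 0 ≤ α) (hα1 : α < 1) (f f' g g' : ℝ → ℝ)
    (hf'int : IntervalIntegrable f' volume a b)
    (hfAC : ∀ t ∈ Set.Icc a b, f t = f a + ∫ s in a..t, f' s)
    (hg : ∀ t ∈ Set.Icc a b, HasDerivAt g (g' t) t)
    (hg' : ContinuousOn g' (Set.Icc a b))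
    (hga : g a = 0) (hgb : g b = 0) :
    ∫ t in a..b, rlDeriv a α f t * g t = ∫ t in a..b, f t * caputoDerivR b α g t := by
  set k : ℝ → ℝ := fun x => x ^ (1 - α - 1) with hkdef
  set c : ℝ := 1 / Real.Gamma (1 - α) with hc
  have hk : ∀ x y, IntervalIntegrable k volume x y := fun x y =>
    intervalIntegral.intervalIntegrable_rpow' (by linarith)
  set h : ℝ → ℝ := fun t => c * (f a * k (t - a) + ∫ τ in a..t, k (t - τ) * f' τ) with hh
  have hsub : ∀ T ∈ Icc a b, IntervalIntegrable f' volume a T := fun T hT =>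
    hf'int.mono_set (by rw [uIcc_of_le hT.1, uIcc_of_le hab.le]; exact Icc_subset_Icc_right hT.2)
  -- `F = ∫ h`
  have hF : ∀ T ∈ Icc a b, fracInt a (1 - α) f T = ∫ t in a..T, h t := by
    intro T hT
    have := frac_primitive a T hT.1 k f f' hk (hsub T hT)
      (fun t ht => hfAC t ⟨ht.1, ht.2.trans hT.2⟩)
    simp only [hh, intervalIntegral.integral_const_mul]
    rw [← this]
    rfl
  have hhint : IntervalIntegrable h volume a b := by
    have hk1 : IntervalIntegrable (fun t => k (t - a)) volume a b := by
      simpa using (hk 0 (b - a)).comp_sub_right a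
    have i1 := tri_integrable a b hab.le _ _ _
      (triPhi_int_cont a b hab.le k f' (fun _ => 1) (hk _ _) hf'int continuousOn_const)
    simp only [mul_one] at i1
    exact ((hk1.const_mul _).add i1).const_mul c
  have hfint : IntervalIntegrable f volume a b := by
    have hc1 : ContinuousOn (fun t => f a + ∫ s in a..t, f' s) (uIcc a b) :=
      continuousOn_const.add (intervalIntegral.continuousOn_primitive_interval' hf'int left_mem_uIcc)
    rw [uIcc_of_le hab.le] at hc1
    exact (hc1.congr hfAC).intervalIntegrable_of_Icc hab.le
  have hg'int : IntervalIntegrable g' volume a b := hg'.intervalIntegrable_of_Icc hab.le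
  -- left side
  have hL : ∫ t in a..b, rlDeriv a α f t * g t = ∫ t in a..b, h t * g t := by
    apply intervalIntegral.integral_congr_ae
    have hb : ∀ᵐ x : ℝ, x ≠ b := by simp [ae_iff]
    filter_upwards [hhint.ae_hasDerivAt_integral, hb] with t ht htb htm
    rw [uIoc_of_le hab.le] at htm
    have hto : t ∈ Ioo a b := ⟨htm.1, lt_of_le_of_ne htm.2 htb⟩
    have hd := ht (by rw [uIcc_of_le hab.le]; exact Ioo_subset_Icc_self hto) a left_mem_uIcc
    have he : fracInt a (1 - α) f =ᶠ[nhds t] fun x => ∫ s in a..x, h s := by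
      filter_upwards [Ioo_mem_nhds hto.1 hto.2] with x hx
      exact hF x (Ioo_subset_Icc_self hx)
    rw [rlDeriv, (hd.congr_of_eventuallyEq he).deriv]
  have hL2 : ∫ t in a..b, h t * g t = - ∫ t in a..b, fracInt a (1 - α) f t * g' t := by
    have e := swap_one a b hab.le h g' hhint hg'int
    have e1 : ∫ t in a..b, fracInt a (1 - α) f t * g' t =
        ∫ t in a..b, (∫ τ in a..t, h τ) * g' t := by
      apply intervalIntegral.integral_congr
      intro t ht
      rw [uIcc_of_le hab.le] at ht
      simp only [hF t ht]
    rw [e1, e, ← intervalIntegral.integral_neg]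
    apply intervalIntegral.integral_congr
    intro t ht
    rw [uIcc_of_le hab.le] at ht
    have : ∫ s in t..b, g' s = g b - g t := by
      apply intervalIntegral.integral_eq_sub_of_hasDerivAt
      · intro s hs
        rw [uIcc_of_le ht.2] at hs
        exact hg s ⟨ht.1.trans hs.1, hs.2⟩
      · exact (hg'.mono (Icc_subset_Icc_left ht.1)).intervalIntegrable_of_Icc ht.2
    simp only [this, hgb]
    ring
  have hM := tri_swap a b hab.le k f g'
    (triPhi_int_cont a b hab.le k f g' (hk _ _) hfint hg')
  have hA : ∫ t in a..b, fracInt a (1 - α) f t * g' t =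
      c * ∫ t in a..b, (∫ τ in a..t, k (t - τ) * f τ) * g' t := by
    rw [← intervalIntegral.integral_const_mul]
    congr 1
    ext t
    simp only [fracInt, hkdef, hc]
    ring
  have hB : ∫ t in a..b, f t * caputoDerivR b α g t =
      - (c * ∫ τ in a..b, f τ * (∫ t in τ..b, k (t - τ) * g' t)) := by
    rw [← intervalIntegral.integral_const_mul, ← intervalIntegral.integral_neg]
    apply intervalIntegral.integral_congr
    intro t ht
    rw [uIcc_of_le hab.le] at ht
    have : ∫ τ in t..b, (τ - t) ^ (1 - α - 1) * deriv g τ = ∫ τ in t..b, k (τ - t) * g' τ := by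
      apply intervalIntegral.integral_congr
      intro s hs
      rw [uIcc_of_le ht.2] at hs
      simp only [hkdef, (hg s ⟨ht.1.trans hs.1, hs.2⟩).deriv]
    simp only [caputoDerivR, fracIntR, this]
    ring
  rw [hL, hL2, hA, hB, hM]
end
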